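/- Let F be a field and σ : F → F a field automorphism of finite order m, and let n ≤ m. Let h, h' ∈ F^n each have entries linearly independent over F^σ, and suppose the entries of h and the entries of h' span the same F^σ-subspace of F. Then for every T ⊆ ℤ, the codes C_(σ,h,T) and C_(σ,h',T) are F^σ-linearly rank equivalent: there exists an invertible n×n matrix P with entries in F^σ such that C_(σ,h',T) = { cP : c ∈ C_(σ,h,T) }. -/

import Mathlib

/-- The fixed subfield of a field automorphism `σ : F ≃+* F`. -/
def fixedField {F : Type*} [Field F] (σ : F ≃+* F) : Subfield F where
  carrier := {x | σ x = x}
  mul_mem' := by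
    intro a b ha hb
    simp only [Set.mem_setOf_eq] at *
    rw [map_mul, ha, hb]
  one_mem' := by simp only [Set.mem_setOf_eq, map_one]
  add_mem' := by
    intro a b ha hb
    simp only [Set.mem_setOf_eq] at *
    rw [map_add, ha, hb]
  zero_mem' := by simp only [Set.mem_setOf_eq, map_zero]
  neg_mem' := by
    intro a ha
    simp only [Set.mem_setOf_eq] at *
    rw [map_neg, ha]
  inv_mem' := by
    intro a ha
    simp only [Set.mem_setOf_eq] at *
    rw [map_inv₀, ha]

/-- The code `C_(σ,h,T)`: vectors whose `i`-th syndromes with respect to `h` vanish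
for all `i ∈ T`. -/
def code {F : Type*} [Field F] {ι : Type*} [Fintype ι] (σ : F ≃+* F) (h : ι → F)
    (T : Set ℤ) : Set (ι → F) :=
  {v : ι → F | ∀ i ∈ T, ∑ j, v j * (σ ^ i) (h j) = 0}

theorem zpow_apply_of_mem_fixedField {F : Type*} [Field F] {σ : F ≃+* F} {a : F}
    (ha : a ∈ fixedField σ) (i : ℤ) : (σ ^ i) a = a :=
  (MulAction.stabilizer (RingAut F) a).zpow_mem (x := σ) ha i

/-- Syndromes with respect to `B h'` are those with respect to `h'` after multiplying by `B`. -/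
theorem mem_code_iff_vecMul_mem_code {F : Type*} [Field F] {ι κ : Type*} [Fintype ι] [Fintype κ]
    {σ : F ≃+* F} {h : ι → F} {h' : κ → F} (B : Matrix ι κ (fixedField σ))
    (hB : ∀ k, ∑ j, B k j • h' j = h k) (T : Set ℤ) (c : ι → F) :
    c ∈ code σ h T ↔ Matrix.vecMul c (B.map (fixedField σ).subtype) ∈ code σ h' T := by
  refine forall₂_congr fun i _ => ?_
  suffices ∑ k, c k * (σ ^ i) (h k) =
      ∑ j, Matrix.vecMul c (B.map (fixedField σ).subtype) j * (σ ^ i) (h' j) by rw [this]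
  simp only [← hB, Subfield.smul_def, smul_eq_mul, map_sum, map_mul,
    zpow_apply_of_mem_fixedField (B _ _).2, Matrix.vecMul, dotProduct, Matrix.map_apply,
    Subfield.subtype_apply, Finset.mul_sum, Finset.sum_mul, mul_assoc]
  exact Finset.sum_comm

/-- Change-of-coordinate matrices between two families, one of them linearly independent,
are inverse to each other. -/
theorem LinearIndependent.matrix_mul_eq_one {K V ι κ : Type*} [Ring K] [AddCommGroup V]
    [Module K V] [Fintype ι] [DecidableEq ι] [Fintype κ] {h : κ → V} {h' : ι → V}
    (hh' : LinearIndependent K h') {A : Matrix ι κ K} {B : Matrix κ ι K}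
    (hA : ∀ i, ∑ k, A i k • h k = h' i) (hB : ∀ k, ∑ j, B k j • h' j = h k) : A * B = 1 := by
  ext i j
  refine congrFun (f := (A * B) i) (g := (1 : Matrix ι ι K) i)
    (hh'.fintypeLinearCombination_injective ?_) j
  simp only [Fintype.linearCombination_apply, Matrix.mul_apply, Finset.sum_smul, mul_smul]
  rw [Finset.sum_comm]
  simp [← Finset.smul_sum, hB, hA, Matrix.one_apply]

/-- Codes defined by vectors `h`, `h'` spanning the same `F^σ`-subspace are
`F^σ`-linearly rank equivalent. -/
theorem rank_equivalence_same_span {F : Type*} [Field F]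
    (σ : F ≃+* F) (m : ℕ) (hm0 : 0 < m) (hord : orderOf σ = m)
    {n : ℕ} (hn : n ≤ m) (h h' : Fin n → F)
    (hh : LinearIndependent (fixedField σ) h)
    (hh' : LinearIndependent (fixedField σ) h')
    (hspan : Submodule.span (fixedField σ) (Set.range h) =
      Submodule.span (fixedField σ) (Set.range h'))
    (T : Set ℤ) :
    ∃ P : Matrix (Fin n) (Fin n) F, (∀ i j, P i j ∈ fixedField σ) ∧ IsUnit P ∧
      code σ h' T = (fun c => Matrix.vecMul c P) '' code σ h T := by
  have hA : ∀ i, ∃ a : Fin n → fixedField σ, ∑ k, a k • h k = h' i := fun i =>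
    (Submodule.mem_span_range_iff_exists_fun _).mp
      (hspan ▸ Submodule.subset_span (Set.mem_range_self i))
  have hB : ∀ k, ∃ b : Fin n → fixedField σ, ∑ j, b j • h' j = h k := fun k =>
    (Submodule.mem_span_range_iff_exists_fun _).mp
      (hspan ▸ Submodule.subset_span (Set.mem_range_self k))
  obtain ⟨A, hA⟩ : ∃ A : Matrix (Fin n) (Fin n) (fixedField σ), ∀ i, ∑ k, A i k • h k = h' i :=
    Classical.skolem.mp hA
  obtain ⟨B, hB⟩ : ∃ B : Matrix (Fin n) (Fin n) (fixedField σ), ∀ k, ∑ j, B k j • h' j = h k :=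
    Classical.skolem.mp hB
  let P := B.map (fixedField σ).subtype
  let Q := A.map (fixedField σ).subtype
  have hQP : Q * P = 1 := by
    rw [← Matrix.map_mul, hh'.matrix_mul_eq_one hA hB]
    exact Matrix.map_one _ (map_zero _) (map_one _)
  refine ⟨P, fun i j => (B i j).2, .of_mul_eq_one_right Q hQP, ?_⟩
  ext v
  constructor
  · intro hv
    exact ⟨Matrix.vecMul v Q, (mem_code_iff_vecMul_mem_code A hA T v).mp hv, by
      simp [Matrix.vecMul_vecMul, hQP]⟩
  · rintro ⟨c, hc, rfl⟩
    exact (mem_code_iff_vecMul_mem_code B hB T c).mp hc
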